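/- For ε ∈ [0,1], let ρ_AB^{(ε)} = (1−ε)|ψ⟩⟨ψ| + ε I/4 be the two-qubit isotropic state, where ψ = (|00⟩ + |11⟩)/√2, and define λ(ε) = inf{ μ(σ_AB) : σ_AB a two-qubit density matrix with ⟨ψ| σ_AB |ψ⟩ ≥ 1 − 3ε/4 }. Then μ_ent(ρ_AB^{(ε)}) = λ(ε). -/

import Mathlib

open scoped Matrix Kronecker ComplexOrder
open Matrix

noncomputable section

/-- Partial trace over the second (B) system. -/
def ptrB {A B : Type*} [Fintype B] (ρ : Matrix (A × B) (A × B) ℂ) : Matrix A A ℂ :=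
  fun i j => ∑ k, ρ (i, k) (j, k)

/-- Partial trace over the first (A) system. -/
def ptrA {A B : Type*} [Fintype A] (ρ : Matrix (A × B) (A × B) ℂ) : Matrix B B ℂ :=
  fun k l => ∑ i, ρ (i, k) (i, l)

/-- A density matrix: positive semidefinite with trace one. -/
def IsDensity {n : Type*} [Fintype n] (ρ : Matrix n n ℂ) : Prop :=
  ρ.PosSemidef ∧ ρ.trace = 1

/-- Maximal correlation of a bipartite state. -/
def mu {A B : Type*} [Fintype A] [Fintype B] (ρ : Matrix (A × B) (A × B) ℂ) : ℝ :=
  sSup {r : ℝ | ∃ (X : Matrix A A ℂ) (Y : Matrix B B ℂ),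
    ((ptrB ρ) * X).trace = 0 ∧ ((ptrA ρ) * Y).trace = 0 ∧
    ((ptrB ρ) * (X * Xᴴ)).trace = 1 ∧ ((ptrA ρ) * (Y * Yᴴ)).trace = 1 ∧
    r = ‖(ρ * (X ⊗ₖ Yᴴ)).trace‖}

/-- Maximal entanglement: infimum over finite decompositions of the max correlation. -/
def muEnt {A B : Type*} [Fintype A] [Fintype B] (ρ : Matrix (A × B) (A × B) ℂ) : ℝ :=
  sInf {r : ℝ | ∃ (m : ℕ) (p : Fin m → ℝ) (τ : Fin m → Matrix (A × B) (A × B) ℂ),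
    (∀ i, 0 ≤ p i) ∧ (∑ i, p i) = 1 ∧ (∀ i, IsDensity (τ i)) ∧
    ρ = ∑ i, p i • τ i ∧ r = ⨆ i, mu (τ i)}

/-- Application of a product channel given by local Kraus operators. -/
def applyLocal {A B A' B' ι κ : Type*} [Fintype A] [Fintype B] [Fintype ι] [Fintype κ]
    (K : ι → Matrix A' A ℂ) (L : κ → Matrix B' B ℂ)
    (ρ : Matrix (A × B) (A × B) ℂ) : Matrix (A' × B') (A' × B') ℂ :=
  ∑ k, ∑ m, (K k ⊗ₖ L m) * ρ * (K k ⊗ₖ L m)ᴴ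

/-- Tensor product of two bipartite states, with the A-systems grouped together. -/
def prodState {A B A' B' : Type*}
    (ρ : Matrix (A × B) (A × B) ℂ) (σ : Matrix (A' × B') (A' × B') ℂ) :
    Matrix ((A × A') × (B × B')) ((A × A') × (B × B')) ℂ :=
  fun x y => ρ (x.1.1, x.2.1) (y.1.1, y.2.1) * σ (x.1.2, x.2.2) (y.1.2, y.2.2)

/-- n-fold tensor power of a bipartite state, with all A-systems grouped together. -/
def powState {A B : Type*} (ρ : Matrix (A × B) (A × B) ℂ) (n : ℕ) :
    Matrix ((Fin n → A) × (Fin n → B)) ((Fin n → A) × (Fin n → B)) ℂ :=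
  fun x y => ∏ i, ρ (x.1 i, x.2 i) (y.1 i, y.2 i)

/-- The two-qubit Bell vector (|00⟩+|11⟩)/√2. -/
def bellVec : Fin 2 × Fin 2 → ℂ := fun p => if p.1 = p.2 then 1 / (Real.sqrt 2 : ℂ) else 0

/-- The positive semidefinite square root of a positive semidefinite matrix
(the definition of the older Mathlib, which has since been removed). -/
def Matrix.PosSemidef.sqrt {n 𝕜 : Type*} [Fintype n] [RCLike 𝕜] [DecidableEq n]
    {A : Matrix n n 𝕜} (hA : A.PosSemidef) : Matrix n n 𝕜 :=
  hA.1.eigenvectorUnitary.1 * diagonal ((↑) ∘ Real.sqrt ∘ hA.1.eigenvalues) *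
    (star hA.1.eigenvectorUnitary : Matrix n n 𝕜)

/-- Inverse of the positive semidefinite square root. -/
def invSqrt {n : Type*} [Fintype n] [DecidableEq n] (M : Matrix n n ℂ) : Matrix n n ℂ :=
  letI := Classical.dec M.PosSemidef
  if h : M.PosSemidef then h.sqrt⁻¹ else 0


/-- The two-qubit isotropic state `(1-ε)|ψ⟩⟨ψ| + ε I/4`. -/
def isoState (ε : ℝ) : Matrix (Fin 2 × Fin 2) (Fin 2 × Fin 2) ℂ :=
  (1 - ε) • Matrix.vecMulVec bellVec (star bellVec) + (ε / 4) • (1 : Matrix (Fin 2 × Fin 2) (Fin 2 × Fin 2) ℂ)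

/-- `λ(ε)`: the smallest maximal correlation among two-qubit states with Bell fidelity
at least `1 - 3ε/4`. -/
def lamEps (ε : ℝ) : ℝ :=
  sInf {r : ℝ | ∃ σ : Matrix (Fin 2 × Fin 2) (Fin 2 × Fin 2) ℂ,
    IsDensity σ ∧ 1 - 3 * ε / 4 ≤ (star bellVec ⬝ᵥ σ.mulVec bellVec).re ∧ r = mu σ}

section Unitaries

variable {n : Type*} [Fintype n] [DecidableEq n] {W : Matrix n n ℂ}

lemma conj_cancel (hW : Wᴴ * W = 1) (Z : Matrix n n ℂ) : Wᴴ * (W * Z * Wᴴ) * W = Z := by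
  simp only [Matrix.mul_assoc, hW, Matrix.mul_one]
  rw [← Matrix.mul_assoc, hW, Matrix.one_mul]

lemma conjTranspose_conj_square (hW : W * Wᴴ = 1) (Z : Matrix n n ℂ) :
    (Wᴴ * Z * W) * (Wᴴ * Z * W)ᴴ = Wᴴ * (Z * Zᴴ) * W := by
  simp only [conjTranspose_mul, conjTranspose_conjTranspose, Matrix.mul_assoc]
  rw [← Matrix.mul_assoc W, hW, Matrix.one_mul]

lemma conj_square (hW : Wᴴ * W = 1) (Z : Matrix n n ℂ) :
    (W * Z * Wᴴ) * (W * Z * Wᴴ)ᴴ = W * (Z * Zᴴ) * Wᴴ := by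
  simpa using conjTranspose_conj_square (W := Wᴴ) (by simpa using hW) Z

end Unitaries

section LocalUnitaries

variable {A B : Type*} [Fintype A] [Fintype B]

lemma trace_ptrB_mul [DecidableEq B] (ρ : Matrix (A × B) (A × B) ℂ) (X : Matrix A A ℂ) :
    (ptrB ρ * X).trace = (ρ * (X ⊗ₖ (1 : Matrix B B ℂ))).trace := by
  simp only [Matrix.trace, Matrix.diag_apply, Matrix.mul_apply, ptrB, kroneckerMap_apply,
    Fintype.sum_prod_type, Matrix.one_apply, mul_ite, mul_one, mul_zero, Finset.sum_ite_eq',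
    Finset.mem_univ, if_true, Finset.sum_mul]
  exact Finset.sum_congr rfl fun i _ => Finset.sum_comm

lemma trace_ptrA_mul [DecidableEq A] (ρ : Matrix (A × B) (A × B) ℂ) (Y : Matrix B B ℂ) :
    (ptrA ρ * Y).trace = (ρ * ((1 : Matrix A A ℂ) ⊗ₖ Y)).trace := by
  simp only [Matrix.trace, Matrix.diag_apply, Matrix.mul_apply, ptrA, kroneckerMap_apply,
    Fintype.sum_prod_type_right, Matrix.one_apply, ite_mul, one_mul, zero_mul, mul_ite, mul_zero,
    Finset.sum_ite_eq', Finset.mem_univ, if_true, Finset.sum_mul]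
  exact Finset.sum_congr rfl fun i _ => Finset.sum_comm

/-- Conjugation of a bipartite matrix by a product operator. -/
def localConj (U : Matrix A A ℂ) (V : Matrix B B ℂ) (ρ : Matrix (A × B) (A × B) ℂ) :
    Matrix (A × B) (A × B) ℂ :=
  (U ⊗ₖ V) * ρ * (U ⊗ₖ V)ᴴ

lemma trace_localConj_mul (U X : Matrix A A ℂ) (V Y : Matrix B B ℂ)
    (ρ : Matrix (A × B) (A × B) ℂ) :
    (localConj U V ρ * (X ⊗ₖ Y)).trace = (ρ * ((Uᴴ * X * U) ⊗ₖ (Vᴴ * Y * V))).trace := by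
  rw [localConj, Matrix.mul_assoc, Matrix.mul_assoc, Matrix.trace_mul_comm, mul_kronecker_mul,
    mul_kronecker_mul, conjTranspose_kronecker, Matrix.mul_assoc, Matrix.mul_assoc]

variable [DecidableEq A] [DecidableEq B]

lemma mu_localConj {U : Matrix A A ℂ} {V : Matrix B B ℂ} (hU : Uᴴ * U = 1) (hV : Vᴴ * V = 1)
    (ρ : Matrix (A × B) (A × B) ℂ) : mu (localConj U V ρ) = mu ρ := by
  have hU' : U * Uᴴ = 1 := mul_eq_one_comm.mp hU
  have hV' : V * Vᴴ = 1 := mul_eq_one_comm.mp hV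
  have hmarg (X : Matrix A A ℂ) :
      (ptrB (localConj U V ρ) * X).trace = (ptrB ρ * (Uᴴ * X * U)).trace := by
    rw [trace_ptrB_mul, trace_ptrB_mul, trace_localConj_mul, Matrix.mul_one, hV]
  have hmarg' (Y : Matrix B B ℂ) :
      (ptrA (localConj U V ρ) * Y).trace = (ptrA ρ * (Vᴴ * Y * V)).trace := by
    rw [trace_ptrA_mul, trace_ptrA_mul, trace_localConj_mul, Matrix.mul_one, hU]
  unfold mu
  congr 1
  ext r
  constructor
  · rintro ⟨X, Y, h₁, h₂, h₃, h₄, rfl⟩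
    refine ⟨Uᴴ * X * U, Vᴴ * Y * V, ?_, ?_, ?_, ?_, ?_⟩
    · rw [← hmarg, h₁]
    · rw [← hmarg', h₂]
    · rw [conjTranspose_conj_square hU', ← hmarg, h₃]
    · rw [conjTranspose_conj_square hV', ← hmarg', h₄]
    · rw [trace_localConj_mul]
      simp only [conjTranspose_mul, conjTranspose_conjTranspose, Matrix.mul_assoc]
  · rintro ⟨X, Y, h₁, h₂, h₃, h₄, rfl⟩
    refine ⟨U * X * Uᴴ, V * Y * Vᴴ, ?_, ?_, ?_, ?_, ?_⟩
    · rw [hmarg, conj_cancel hU, h₁]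
    · rw [hmarg', conj_cancel hV, h₂]
    · rw [conj_square hU, hmarg, conj_cancel hU, h₃]
    · rw [conj_square hV, hmarg', conj_cancel hV, h₄]
    · have : (V * Y * Vᴴ)ᴴ = V * Yᴴ * Vᴴ := by
        simp only [conjTranspose_mul, conjTranspose_conjTranspose, Matrix.mul_assoc]
      rw [this, trace_localConj_mul, conj_cancel hU, conj_cancel hV]

lemma IsDensity.localConj {U : Matrix A A ℂ} {V : Matrix B B ℂ} (hU : Uᴴ * U = 1)
    (hV : Vᴴ * V = 1) {ρ : Matrix (A × B) (A × B) ℂ} (hρ : IsDensity ρ) :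
    IsDensity (localConj U V ρ) := by
  refine ⟨hρ.1.mul_mul_conjTranspose_same _, ?_⟩
  have h := trace_localConj_mul U 1 V 1 ρ
  rw [Matrix.mul_one, Matrix.mul_one, hU, hV, one_kronecker_one, Matrix.mul_one,
    Matrix.mul_one] at h
  rw [h, hρ.2]

/-- The mixtures of density matrices of maximal correlation at most `r`. -/
def mixtures (A B : Type*) [Fintype A] [Fintype B] (r : ℝ) :
    Set (Matrix (A × B) (A × B) ℂ) :=
  convexHull ℝ {τ | IsDensity τ ∧ mu τ ≤ r}

lemma localConj_mem_mixtures {U : Matrix A A ℂ} {V : Matrix B B ℂ} (hU : Uᴴ * U = 1)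
    (hV : Vᴴ * V = 1) {r : ℝ} {ρ : Matrix (A × B) (A × B) ℂ} (hρ : ρ ∈ mixtures A B r) :
    localConj U V ρ ∈ mixtures A B r := by
  have hconv : Convex ℝ {ρ | localConj U V ρ ∈ mixtures A B r} := by
    intro x hx y hy a b ha hb hab
    have h := convex_convexHull ℝ _ hx hy ha hb hab
    simpa [mixtures, localConj, Matrix.mul_add, Matrix.add_mul] using h
  refine convexHull_min (fun τ hτ => ?_) hconv hρ
  exact subset_convexHull ℝ _ ⟨hτ.1.localConj hU hV, (mu_localConj hU hV τ).trans_le hτ.2⟩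

end LocalUnitaries

section MaximalEntanglement

variable {A B : Type*} [Fintype A] [Fintype B]

lemma mu_nonneg (ρ : Matrix (A × B) (A × B) ℂ) : 0 ≤ mu ρ := by
  refine Real.sSup_nonneg ?_
  rintro _ ⟨X, Y, -, -, -, -, rfl⟩
  exact norm_nonneg _

lemma muEnt_le_of_mem_mixtures {r : ℝ} {ρ : Matrix (A × B) (A × B) ℂ}
    (hρ : ρ ∈ mixtures A B r) : muEnt ρ ≤ r := by
  obtain ⟨ι, _, w, z, hw, hw1, hz, rfl⟩ := mem_convexHull_iff_exists_fintype.mp hρ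
  let e := Fintype.equivFin ι
  have hne : Nonempty ι := by
    by_contra h
    rw [not_nonempty_iff] at h
    simp at hw1
  have : Nonempty (Fin (Fintype.card ι)) := ⟨e hne.some⟩
  refine le_trans (b := ⨆ i, mu ((z ∘ e.symm) i)) (csInf_le ?_ ⟨Fintype.card ι, w ∘ e.symm,
    z ∘ e.symm, fun i => hw _, ?_, fun i => (hz _).1, ?_, rfl⟩) (ciSup_le fun i => (hz _).2)
  · refine ⟨0, ?_⟩
    rintro _ ⟨m, p, τ, -, -, -, -, rfl⟩
    exact Real.iSup_nonneg fun i => mu_nonneg _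
  · rw [← hw1]
    exact e.symm.sum_comp w
  · exact (e.symm.sum_comp fun i => w i • z i).symm

end MaximalEntanglement

section Twirling

/-- The overlap `⟨ψ|M|ψ⟩` with the Bell vector. -/
def bellOverlap (M : Matrix (Fin 2 × Fin 2) (Fin 2 × Fin 2) ℂ) : ℂ :=
  star bellVec ⬝ᵥ M.mulVec bellVec

lemma ofReal_sqrt_two_inv_sq : ((Real.sqrt 2 : ℂ))⁻¹ * ((Real.sqrt 2 : ℂ))⁻¹ = 1 / 2 := by
  rw [← mul_inv, ← Complex.ofReal_mul, Real.mul_self_sqrt (by norm_num)]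
  norm_num

lemma bellOverlap_eq (M : Matrix (Fin 2 × Fin 2) (Fin 2 × Fin 2) ℂ) :
    bellOverlap M =
      (M (0, 0) (0, 0) + M (0, 0) (1, 1) + M (1, 1) (0, 0) + M (1, 1) (1, 1)) / 2 := by
  simp [bellOverlap, bellVec, dotProduct, Matrix.mulVec, Fintype.sum_prod_type]
  linear_combination (M (0, 0) (0, 0) + M (0, 0) (1, 1) + M (1, 1) (0, 0) + M (1, 1) (1, 1)) *
    ofReal_sqrt_two_inv_sq

lemma vecMulVec_bellVec : Matrix.vecMulVec bellVec (star bellVec) =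
    Matrix.of fun i j => if i.1 = i.2 ∧ j.1 = j.2 then (1 / 2 : ℂ) else 0 := by
  ext ⟨i, i'⟩ ⟨j, j'⟩
  by_cases hi : i = i' <;> by_cases hj : j = j' <;>
    simp [Matrix.vecMulVec, bellVec, hi, hj]
  simpa using ofReal_sqrt_two_inv_sq

/-- The isotropic mixture `f|ψ⟩⟨ψ| + (t - f)/3 (I - |ψ⟩⟨ψ|)`. -/
def isotropic (t f : ℂ) : Matrix (Fin 2 × Fin 2) (Fin 2 × Fin 2) ℂ :=
  f • Matrix.vecMulVec bellVec (star bellVec) +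
    ((t - f) / 3) • (1 - Matrix.vecMulVec bellVec (star bellVec))

/-- The average over conjugations by `1` and `Z ⊗ Z`. -/
def phaseTwirl (M : Matrix (Fin 2 × Fin 2) (Fin 2 × Fin 2) ℂ) :
    Matrix (Fin 2 × Fin 2) (Fin 2 × Fin 2) ℂ :=
  (1 / 2 : ℝ) • M + (1 / 2 : ℝ) • localConj !![1, 0; 0, -1] !![1, 0; 0, -1] M

/-- The average over conjugations by `1` and `X ⊗ X`. -/
def flipTwirl (M : Matrix (Fin 2 × Fin 2) (Fin 2 × Fin 2) ℂ) :
    Matrix (Fin 2 × Fin 2) (Fin 2 × Fin 2) ℂ :=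
  (1 / 2 : ℝ) • M + (1 / 2 : ℝ) • localConj !![0, 1; 1, 0] !![0, 1; 1, 0] M

/-- A unitary that permutes the three Pauli matrices cyclically under conjugation. -/
def pauliCycle : Matrix (Fin 2) (Fin 2) ℂ :=
  !![(1 - Complex.I) / 2, (-1 - Complex.I) / 2; (1 - Complex.I) / 2, (1 + Complex.I) / 2]

/-- The average over the cyclic group generated by `pauliCycle` and its complex conjugate. -/
def cycleTwirl (M : Matrix (Fin 2 × Fin 2) (Fin 2 × Fin 2) ℂ) :
    Matrix (Fin 2 × Fin 2) (Fin 2 × Fin 2) ℂ :=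
  (1 / 3 : ℝ) • M + (2 / 3 : ℝ) • ((1 / 2 : ℝ) • localConj pauliCycle pauliCycleᵀᴴ M +
    (1 / 2 : ℝ) • localConj pauliCycleᴴ pauliCycleᵀ M)

lemma pauliCycle_unitary : pauliCycleᴴ * pauliCycle = 1 := by
  ext i j
  fin_cases i <;> fin_cases j <;>
    simp [pauliCycle, Matrix.mul_apply, Fin.sum_univ_two] <;> ring_nf <;>
    simp [Complex.I_sq, map_ofNat] <;> norm_num

lemma pauliCycle_unitary' : pauliCycle * pauliCycleᴴ = 1 :=
  mul_eq_one_comm.mp pauliCycle_unitary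

variable {r : ℝ} {M : Matrix (Fin 2 × Fin 2) (Fin 2 × Fin 2) ℂ}

lemma average_mem_mixtures {N : Matrix (Fin 2 × Fin 2) (Fin 2 × Fin 2) ℂ}
    (hM : M ∈ mixtures (Fin 2) (Fin 2) r) (hN : N ∈ mixtures (Fin 2) (Fin 2) r) :
    (1 / 2 : ℝ) • M + (1 / 2 : ℝ) • N ∈ mixtures (Fin 2) (Fin 2) r :=
  convex_convexHull ℝ _ hM hN (by norm_num) (by norm_num) (by norm_num)

lemma phaseTwirl_mem (hM : M ∈ mixtures (Fin 2) (Fin 2) r) :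
    phaseTwirl M ∈ mixtures (Fin 2) (Fin 2) r := by
  have h : (!![1, 0; 0, -1] : Matrix (Fin 2) (Fin 2) ℂ)ᴴ * !![1, 0; 0, -1] = 1 := by
    ext i j
    fin_cases i <;> fin_cases j <;> simp [Matrix.mul_apply]
  exact average_mem_mixtures hM (localConj_mem_mixtures h h hM)

lemma flipTwirl_mem (hM : M ∈ mixtures (Fin 2) (Fin 2) r) :
    flipTwirl M ∈ mixtures (Fin 2) (Fin 2) r := by
  have h : (!![0, 1; 1, 0] : Matrix (Fin 2) (Fin 2) ℂ)ᴴ * !![0, 1; 1, 0] = 1 := by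
    ext i j
    fin_cases i <;> fin_cases j <;> simp [Matrix.mul_apply]
  exact average_mem_mixtures hM (localConj_mem_mixtures h h hM)

lemma cycleTwirl_mem (hM : M ∈ mixtures (Fin 2) (Fin 2) r) :
    cycleTwirl M ∈ mixtures (Fin 2) (Fin 2) r := by
  have h₁ : (pauliCycleᵀᴴ)ᴴ * pauliCycleᵀᴴ = 1 := by
    have h := congrArg Matrix.transpose pauliCycle_unitary
    rw [Matrix.transpose_mul, Matrix.transpose_one] at h
    rw [conjTranspose_conjTranspose]
    exact h
  have h₂ : (pauliCycleᵀ)ᴴ * pauliCycleᵀ = 1 := by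
    exact mul_eq_one_comm.mp (by simpa using h₁)
  have h₃ : (pauliCycleᴴ)ᴴ * pauliCycleᴴ = 1 := by simpa using pauliCycle_unitary'
  exact convex_convexHull ℝ _ hM (average_mem_mixtures
    (localConj_mem_mixtures pauliCycle_unitary h₁ hM) (localConj_mem_mixtures h₃ h₂ hM))
    (by norm_num) (by norm_num) (by norm_num)

lemma phaseTwirl_apply (M : Matrix (Fin 2 × Fin 2) (Fin 2 × Fin 2) ℂ) (i j : Fin 2 × Fin 2) :
    phaseTwirl M i j = if i.1 + i.2 = j.1 + j.2 then M i j else 0 := by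
  obtain ⟨i, i'⟩ := i
  obtain ⟨j, j'⟩ := j
  fin_cases i <;> fin_cases i' <;> fin_cases j <;> fin_cases j' <;>
    simp [phaseTwirl, localConj, Matrix.mul_apply, Fintype.sum_prod_type] <;> ring

lemma flipTwirl_apply (M : Matrix (Fin 2 × Fin 2) (Fin 2 × Fin 2) ℂ) (i j : Fin 2 × Fin 2) :
    flipTwirl M i j = (M i j + M (i.1 + 1, i.2 + 1) (j.1 + 1, j.2 + 1)) / 2 := by
  obtain ⟨i, i'⟩ := i
  obtain ⟨j, j'⟩ := j
  fin_cases i <;> fin_cases i' <;> fin_cases j <;> fin_cases j' <;>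
    simp [flipTwirl, localConj, Matrix.mul_apply, Fintype.sum_prod_type] <;> ring

/-- The matrix, diagonal in the Bell basis, with the given diagonal and antidiagonal entries. -/
def bellDiagonal (a b c d : ℂ) : Matrix (Fin 2 × Fin 2) (Fin 2 × Fin 2) ℂ :=
  Matrix.of fun i j =>
    if i = j then (if i.1 = i.2 then a else b)
    else if i.1 ≠ j.1 ∧ i.2 ≠ j.2 then (if i.1 = i.2 then c else d)
    else 0

lemma flipTwirl_phaseTwirl (M : Matrix (Fin 2 × Fin 2) (Fin 2 × Fin 2) ℂ) :
    flipTwirl (phaseTwirl M) =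
      bellDiagonal ((M (0, 0) (0, 0) + M (1, 1) (1, 1)) / 2)
        ((M (0, 1) (0, 1) + M (1, 0) (1, 0)) / 2) ((M (0, 0) (1, 1) + M (1, 1) (0, 0)) / 2)
        ((M (0, 1) (1, 0) + M (1, 0) (0, 1)) / 2) := by
  ext ⟨i, i'⟩ ⟨j, j'⟩
  fin_cases i <;> fin_cases i' <;> fin_cases j <;> fin_cases j' <;>
    simp [flipTwirl_apply, phaseTwirl_apply, bellDiagonal] <;> ring

set_option maxHeartbeats 2000000 in
lemma cycleTwirl_bellDiagonal (a b c d : ℂ) :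
    cycleTwirl (bellDiagonal a b c d) = isotropic (2 * a + 2 * b) (a + c) := by
  have hI : Complex.I ^ 2 = -1 := Complex.I_sq
  have hI4 : Complex.I ^ 4 = 1 := Complex.I_pow_four
  have hI3 : Complex.I ^ 3 = -Complex.I := Complex.I_pow_three
  rw [isotropic, vecMulVec_bellVec]
  ext ⟨i, i'⟩ ⟨j, j'⟩
  fin_cases i <;> fin_cases i' <;> fin_cases j <;> fin_cases j' <;>
    simp [cycleTwirl, localConj, Matrix.mul_apply, Fintype.sum_prod_type, bellDiagonal,
      pauliCycle, map_ofNat] <;> ring_nf <;>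
    simp only [hI, hI3, hI4] <;> ring

lemma twirl_eq_isotropic (M : Matrix (Fin 2 × Fin 2) (Fin 2 × Fin 2) ℂ) :
    cycleTwirl (flipTwirl (phaseTwirl M)) = isotropic M.trace (bellOverlap M) := by
  rw [flipTwirl_phaseTwirl, cycleTwirl_bellDiagonal, bellOverlap_eq]
  congr 1
  · simp [Matrix.trace, Fintype.sum_prod_type]
    ring
  · ring

lemma isotropic_mem (hM : M ∈ mixtures (Fin 2) (Fin 2) r) :
    isotropic M.trace (bellOverlap M) ∈ mixtures (Fin 2) (Fin 2) r :=
  twirl_eq_isotropic M ▸ cycleTwirl_mem (flipTwirl_mem (phaseTwirl_mem hM))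

end Twirling

section IsotropicStates

lemma bellOverlap_isoState (ε : ℝ) : bellOverlap (isoState ε) = ((1 - 3 * ε / 4 : ℝ) : ℂ) := by
  rw [bellOverlap_eq, isoState, vecMulVec_bellVec]
  simp
  ring

lemma isoState_eq_isotropic (ε : ℝ) :
    isoState ε = isotropic 1 ((1 - 3 * ε / 4 : ℝ) : ℂ) := by
  rw [isoState, isotropic]
  ext i j
  simp
  ring

/-- The product state `|01⟩⟨01|`. -/
def antiState : Matrix (Fin 2 × Fin 2) (Fin 2 × Fin 2) ℂ :=
  Matrix.diagonal (Pi.single (0, 1) 1)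

lemma isDensity_antiState : IsDensity antiState := by
  refine ⟨PosSemidef.diagonal fun i => ?_, by simp [antiState]⟩
  obtain rfl | h := eq_or_ne i (0, 1)
  · simp
  · simp [h]

lemma mu_antiState : mu antiState = 0 := by
  refine le_antisymm (Real.sSup_nonpos ?_) (mu_nonneg _)
  rintro _ ⟨X, Y, h, -, -, -, rfl⟩
  have hX : X 0 0 = 0 := by
    simpa [Matrix.trace, Matrix.mul_apply, ptrB, antiState, Matrix.diagonal, Pi.single_apply]
      using h
  simp [Matrix.trace, antiState, hX, Pi.single_apply]

lemma IsDensity.coe_re_bellOverlap {σ : Matrix (Fin 2 × Fin 2) (Fin 2 × Fin 2) ℂ}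
    (hσ : IsDensity σ) : ((bellOverlap σ).re : ℂ) = bellOverlap σ := by
  have h := (Complex.le_def.mp (hσ.1.dotProduct_mulVec_nonneg bellVec)).2
  exact Complex.ext rfl (by simpa [bellOverlap] using h)

lemma muEnt_isoState_le {ε : ℝ} (h1 : ε ≤ 1) {σ : Matrix (Fin 2 × Fin 2) (Fin 2 × Fin 2) ℂ}
    (hσ : IsDensity σ) (hF : 1 - 3 * ε / 4 ≤ (bellOverlap σ).re) :
    muEnt (isoState ε) ≤ mu σ := by
  refine muEnt_le_of_mem_mixtures ?_
  have hpos : 0 < (bellOverlap σ).re := by linarith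
  have hσmem := isotropic_mem (r := mu σ) (subset_convexHull ℝ _ ⟨hσ, le_rfl⟩)
  have hanti := isotropic_mem (r := mu σ)
    (subset_convexHull ℝ _ ⟨isDensity_antiState, mu_antiState.trans_le (mu_nonneg σ)⟩)
  have hzero : bellOverlap antiState = 0 := by
    simp [bellOverlap_eq, antiState, Matrix.diagonal]
  rw [hσ.2, ← hσ.coe_re_bellOverlap] at hσmem
  rw [isDensity_antiState.2, hzero] at hanti
  set F := (bellOverlap σ).re
  have hmix := convex_convexHull ℝ _ hσmem hanti
    (div_nonneg (by linarith : 0 ≤ 1 - 3 * ε / 4) hpos.le)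
    (sub_nonneg.mpr ((div_le_one hpos).mpr hF)) (add_sub_cancel _ 1)
  have hF0 : (F : ℂ) ≠ 0 := by exact_mod_cast hpos.ne'
  have heq : isoState ε = ((1 - 3 * ε / 4) / F) • isotropic 1 F +
      (1 - (1 - 3 * ε / 4) / F) • isotropic 1 0 := by
    rw [isoState_eq_isotropic]
    ext i j
    simp [isotropic]
    field_simp
    ring
  exact heq ▸ hmix

lemma lamEps_le {ε : ℝ} {σ : Matrix (Fin 2 × Fin 2) (Fin 2 × Fin 2) ℂ}
    (hσ : IsDensity σ) (hF : 1 - 3 * ε / 4 ≤ (bellOverlap σ).re) : lamEps ε ≤ mu σ := by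
  refine csInf_le ⟨0, ?_⟩ ⟨σ, hσ, hF, rfl⟩
  rintro _ ⟨τ, -, -, rfl⟩
  exact mu_nonneg τ

lemma isDensity_isoState {ε : ℝ} (h0 : 0 ≤ ε) (h1 : ε ≤ 1) : IsDensity (isoState ε) := by
  refine ⟨?_, ?_⟩
  · exact ((posSemidef_vecMulVec_self_star bellVec).smul (sub_nonneg.mpr h1)).add
      (PosSemidef.one.smul (by positivity))
  · rw [isoState, vecMulVec_bellVec]
    simp [Matrix.trace, Fintype.sum_prod_type]
    ring

lemma lamEps_le_iSup_mu {ε : ℝ} {m : ℕ} {p : Fin m → ℝ}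
    {τ : Fin m → Matrix (Fin 2 × Fin 2) (Fin 2 × Fin 2) ℂ} (hp : ∀ i, 0 ≤ p i)
    (hp1 : ∑ i, p i = 1) (hτ : ∀ i, IsDensity (τ i)) (hdec : isoState ε = ∑ i, p i • τ i) :
    lamEps ε ≤ ⨆ i, mu (τ i) := by
  have hF : 1 - 3 * ε / 4 = ∑ i, p i * (bellOverlap (τ i)).re := by
    have h := bellOverlap_isoState ε
    rw [hdec, bellOverlap_eq] at h
    have h' := congrArg Complex.re h
    rw [Complex.ofReal_re] at h'
    rw [← h']
    simp only [bellOverlap_eq, Matrix.sum_apply, ← Finset.sum_add_distrib, Finset.sum_div,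
      Complex.re_sum]
    refine Finset.sum_congr rfl fun i _ => ?_
    simp
    ring
  obtain ⟨i, hi⟩ : ∃ i, 1 - 3 * ε / 4 ≤ (bellOverlap (τ i)).re := by
    by_contra! hlt
    obtain ⟨j, -, hj⟩ := Finset.exists_ne_zero_of_sum_ne_zero (hp1 ▸ one_ne_zero)
    have : ∑ i, p i * (bellOverlap (τ i)).re < ∑ i, p i * (1 - 3 * ε / 4) :=
      Finset.sum_lt_sum (fun i _ => mul_le_mul_of_nonneg_left (hlt i).le (hp i))
        ⟨j, Finset.mem_univ j, mul_lt_mul_of_pos_left (hlt j) ((hp j).lt_of_ne' hj)⟩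
    rw [← Finset.sum_mul, hp1, one_mul, ← hF] at this
    exact this.false
  exact (lamEps_le (hτ i) hi).trans
    (le_ciSup (f := fun i => mu (τ i)) (Set.finite_range _).bddAbove i)

end IsotropicStates

/-- The maximal entanglement of the isotropic state equals `λ(ε)`. -/
theorem muEnt_isoState (ε : ℝ) (h0 : 0 ≤ ε) (h1 : ε ≤ 1) :
    muEnt (isoState ε) = lamEps ε := by
  have hiso := isDensity_isoState h0 h1
  refine le_antisymm (le_csInf ?_ ?_) (le_csInf ?_ ?_)
  · refine ⟨_, isoState ε, hiso, ?_, rfl⟩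
    exact (congrArg Complex.re (bellOverlap_isoState ε)).ge
  · rintro _ ⟨σ, hσ, hF, rfl⟩
    exact muEnt_isoState_le h1 hσ hF
  · exact ⟨_, 1, 1, fun _ => isoState ε, fun _ => zero_le_one, by simp, fun _ => hiso, by simp,
      rfl⟩
  · rintro _ ⟨m, p, τ, hp, hp1, hτ, hdec, rfl⟩
    exact lamEps_le_iSup_mu hp hp1 hτ hdec
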